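/- arXiv:2108.11790 — 5 statements merged into one kernel-verified Lean document; each statement's English description precedes it below -/
import Mathlib

section
/- For every integer n ≥ 5, the number of rotation-swap-equivalence classes of binary words of length n that contain at least two occurrences of 'true' and at least two occurrences of 'false', multiplied by n, is at least 2^{n−5}; equivalently, there are at least 2^{n−5}/n such classes. -/
/-- Rotation-swap-equivalence of binary words of length `n`: `w` and `w'` are
equivalent if there is `k : ZMod n` such that either `w' i = w (i + k)` for all `i`,
or `w' i = !w (i + k)` for all `i`. -/
def rotSwapSetoid (n : ℕ) : Setoid (ZMod n → Bool) where
  r w w' := ∃ k : ZMod n, (∀ i, w' i = w (i + k)) ∨ (∀ i, w' i = !w (i + k))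
  iseqv := by
    refine ⟨fun w => ⟨0, Or.inl fun i => by simp⟩, ?_, ?_⟩
    · rintro w w' ⟨k, h | h⟩
      · refine ⟨-k, Or.inl fun i => ?_⟩
        rw [h (i + -k)]
        congr 1
        ring
      · refine ⟨-k, Or.inr fun i => ?_⟩
        rw [h (i + -k), Bool.not_not]
        congr 1
        ring
    · rintro w₁ w₂ w₃ ⟨k, h | h⟩ ⟨k', h' | h'⟩
      · refine ⟨k' + k, Or.inl fun i => ?_⟩
        rw [h' i, h (i + k')]
        congr 1
        ring
      · refine ⟨k' + k, Or.inr fun i => ?_⟩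
        rw [h' i, h (i + k')]
        congr 2
        ring
      · refine ⟨k' + k, Or.inr fun i => ?_⟩
        rw [h' i, h (i + k')]
        congr 2
        ring
      · refine ⟨k' + k, Or.inl fun i => ?_⟩
        rw [h' i, h (i + k'), Bool.not_not]
        congr 1
        ring

/-- For every integer `n ≥ 5`, the number of rotation-swap-equivalence classes of
binary words of length `n` containing at least two occurrences of `true` and at
least two occurrences of `false`, multiplied by `n`, is at least `2^(n-5)`. -/
theorem stmt_3 (n : ℕ) (hn : 5 ≤ n) :
    2 ^ (n - 5) ≤ n * Nat.card {q : Quotient (rotSwapSetoid n) //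
      ∃ w : ZMod n → Bool, Quotient.mk (rotSwapSetoid n) w = q ∧
        2 ≤ Nat.card {i : ZMod n // w i = true} ∧
        2 ≤ Nat.card {i : ZMod n // w i = false}} := by
  have : NeZero n := ⟨by omega⟩
  -- words with prefix `true, true, false, false`
  let W : (Fin (n - 4) → Bool) → ZMod n → Bool := fun v i =>
    if i.val < 2 then true else if h : i.val < 4 then false
      else v ⟨i.val - 4, by have := ZMod.val_lt i; omega⟩
  have hval : ∀ k : ℕ, k < n → ((k : ZMod n)).val = k := fun k hk => ZMod.val_cast_of_lt hk
  have hW : Function.Injective W := by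
    intro v v' h
    funext j
    have hj := congrFun h (((j : ℕ) + 4 : ℕ) : ZMod n)
    have hv := hval ((j : ℕ) + 4) (by omega)
    simp only [W, hv] at hj
    simpa using hj
  have two : ∀ (w : ZMod n → Bool) (b : Bool) (x y : ℕ), x < n → y < n → x ≠ y →
      w x = b → w y = b → 2 ≤ Nat.card {i : ZMod n // w i = b} := by
    intro w b x y hx hy hxy h1 h2
    have : Nontrivial {i : ZMod n // w i = b} :=
      ⟨⟨x, h1⟩, ⟨y, h2⟩, fun h => hxy (by
        rw [← hval x hx, ← hval y hy]; exact congrArg ZMod.val (Subtype.mk.inj h))⟩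
    exact Finite.one_lt_card
  have hgood : ∀ v, 2 ≤ Nat.card {i : ZMod n // W v i = true} ∧
      2 ≤ Nat.card {i : ZMod n // W v i = false} := by
    intro v
    have hs : ∀ k : ℕ, k < 2 → W v k = true := by
      intro k hk
      simp only [W, hval k (by omega)]
      simp [hk]
    have hs' : ∀ k : ℕ, 2 ≤ k → k < 4 → W v k = false := by
      intro k hk hk'
      simp only [W, hval k (by omega)]
      simp [hk']
      omega
    exact ⟨two _ _ 0 1 (by omega) (by omega) (by omega) (hs 0 (by omega)) (hs 1 (by omega)),
      two _ _ 2 3 (by omega) (by omega) (by omega) (hs' 2 (by omega) (by omega))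
        (hs' 3 (by omega) (by omega))⟩
  have hrep : ∀ v, ∃ p : ZMod n × Bool,
      W v = fun i => xor p.2 ((Quotient.mk (rotSwapSetoid n) (W v)).out (i + p.1)) := by
    intro v
    obtain ⟨k, h | h⟩ := Quotient.mk_out (s := rotSwapSetoid n) (W v)
    · exact ⟨(k, false), funext fun i => by simpa using h i⟩
    · exact ⟨(k, true), funext fun i => by simpa using h i⟩
  choose p hp using hrep
  have hinj := Nat.card_le_card_of_injective
    (fun v : Fin (n - 4) → Bool =>
      ((p v, ⟨Quotient.mk (rotSwapSetoid n) (W v), W v, rfl, hgood v⟩) :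
        (ZMod n × Bool) × {q : Quotient (rotSwapSetoid n) //
          ∃ w : ZMod n → Bool, Quotient.mk (rotSwapSetoid n) w = q ∧
            2 ≤ Nat.card {i : ZMod n // w i = true} ∧
            2 ≤ Nat.card {i : ZMod n // w i = false}})) (by
      intro v v' h
      obtain ⟨h1, h2⟩ := Prod.mk.inj h
      have h2 := Subtype.mk.inj h2
      apply hW
      rw [hp v, hp v', h1, h2])
  rw [Nat.card_prod, Nat.card_prod, Nat.card_zmod] at hinj
  have e : Nat.card (Fin (n - 4) → Bool) = 2 * 2 ^ (n - 5) := by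
    rw [Nat.card_eq_fintype_card, Fintype.card_fun, Fintype.card_bool, Fintype.card_fin,
      ← pow_succ']
    congr 1
    omega
  rw [e, Nat.card_eq_fintype_card (α := Bool), Fintype.card_bool, mul_comm n 2, mul_assoc] at hinj
  exact Nat.le_of_mul_le_mul_left hinj (by norm_num)
end

section
/- There exist a real constant c > 0 and a natural number N such that for every integer n ≥ N, the number of rotation-swap-equivalence classes of binary words of length n containing at least two occurrences of 'true' and at least two occurrences of 'false', minus n³, is at least 2^{c·n} (as real numbers). -/
theorem card_words_le (n : ℕ) [NeZero n] (hn : 4 ≤ n) :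
    2 ^ (n - 4) ≤ n * 2 * Nat.card {q : Quotient (rotSwapSetoid n) //
          ∃ w : ZMod n → Bool, Quotient.mk (rotSwapSetoid n) w = q ∧
            2 ≤ Nat.card {i : ZMod n // w i = true} ∧
            2 ≤ Nat.card {i : ZMod n // w i = false}} := by
  classical
  set C := {q : Quotient (rotSwapSetoid n) //
          ∃ w : ZMod n → Bool, Quotient.mk (rotSwapSetoid n) w = q ∧
            2 ≤ Nat.card {i : ZMod n // w i = true} ∧
            2 ≤ Nat.card {i : ZMod n // w i = false}} with hC
  have hinj : ∀ a b : ℕ, a < 4 → b < 4 → ((a : ZMod n) = (b : ZMod n)) → a = b := by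
    intro a b ha hb h
    rw [ZMod.natCast_eq_natCast_iff'] at h
    rwa [Nat.mod_eq_of_lt (by omega), Nat.mod_eq_of_lt (by omega)] at h
  set S : Finset (ZMod n) := (Finset.range 4).image (fun a : ℕ => (a : ZMod n)) with hS
  have hScard : S.card ≤ 4 := le_trans Finset.card_image_le (by simp)
  let g : ({i : ZMod n // i ∉ S} → Bool) → ZMod n → Bool := fun u i =>
    if h : i ∉ S then u ⟨i, h⟩ else decide (i = (0 : ℕ) ∨ i = (1 : ℕ))
  have hmem : ∀ a : ℕ, a < 4 → (a : ZMod n) ∈ S := fun a ha =>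
    Finset.mem_image.2 ⟨a, by simpa using ha, rfl⟩
  have hg : ∀ u (a : ℕ), a < 4 → g u a = decide (a = 0 ∨ a = 1) := by
    intro u a ha
    have h1 := hmem a ha
    simp only [g, h1, not_true_eq_false, dite_false, decide_eq_decide]
    constructor
    · rintro (h | h)
      · exact Or.inl (hinj _ _ ha (by norm_num) h)
      · exact Or.inr (hinj _ _ ha (by norm_num) h)
    · rintro (h | h) <;> simp [h]
  have hgood : ∀ u, 2 ≤ Nat.card {i : ZMod n // g u i = true} ∧
      2 ≤ Nat.card {i : ZMod n // g u i = false} := by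
    intro u
    have two : ∀ (p : ZMod n → Prop) (a b : ℕ), a < 4 → b < 4 → a ≠ b → p a → p b →
        2 ≤ Nat.card {i // p i} := by
      intro p a b ha hb hab pa pb
      have : Nontrivial {i // p i} :=
        ⟨⟨⟨_, pa⟩, ⟨_, pb⟩, fun h => hab (hinj a b ha hb (congrArg Subtype.val h))⟩⟩
      exact Finite.one_lt_card
    constructor
    · apply two _ 0 1 (by norm_num) (by norm_num) (by norm_num)
      · rw [hg u 0 (by norm_num)]; rfl
      · rw [hg u 1 (by norm_num)]; rfl
    · apply two _ 2 3 (by norm_num) (by norm_num) (by norm_num)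
      · rw [hg u 2 (by norm_num)]; rfl
      · rw [hg u 3 (by norm_num)]; rfl
  have hginj : Function.Injective g := by
    intro u v huv
    funext ⟨i, hi⟩
    have := congrFun huv i
    simpa only [g, hi, not_false_eq_true, dite_true] using this
  have key : ∀ u, ∃ x : ZMod n × Bool × C,
      g u = fun i => xor x.2.1 (x.2.2.1.out (i + x.1)) := by
    intro u
    let q : C := ⟨Quotient.mk (rotSwapSetoid n) (g u), g u, rfl, hgood u⟩
    have hq : (rotSwapSetoid n).r q.1.out (g u) :=
      Quotient.exact (s := rotSwapSetoid n) (Quotient.out_eq q.1)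
    obtain ⟨k, h | h⟩ := hq
    · exact ⟨(k, false, q), funext fun i => by simpa using h i⟩
    · exact ⟨(k, true, q), funext fun i => by simpa using h i⟩
  choose f hf using key
  have hfinj : Function.Injective f := by
    intro u v huv
    apply hginj
    rw [hf u, hf v, huv]
  have : Finite C := Subtype.finite
  have hle := Nat.card_le_card_of_injective f hfinj
  have hT : Nat.card ({i : ZMod n // i ∉ S} → Bool) = 2 ^ (n - S.card) := by
    simp [Fintype.card_subtype_compl, ZMod.card]
  rw [hT, Nat.card_prod, Nat.card_prod, Nat.card_zmod, Nat.card_eq_fintype_card,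
    Fintype.card_bool, ← mul_assoc] at hle
  exact le_trans (Nat.pow_le_pow_right (by norm_num) (by omega)) hle

theorem growth : ∃ N : ℕ, ∀ n : ℕ, N ≤ n →
    32 * (n : ℝ) * (2 : ℝ) ^ ((1 / 2 : ℝ) * n) + 32 * (n : ℝ) ^ 4 ≤ 2 ^ n := by
  have hr : (1 : ℝ) < √2 := by
    rw [Real.lt_sqrt (by norm_num)]; norm_num
  have h1 := tendsto_pow_const_div_const_pow_of_one_lt 1 hr
  have h2 := tendsto_pow_const_div_const_pow_of_one_lt 4 (one_lt_two : (1 : ℝ) < 2)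
  have e1 := h1.eventually (gt_mem_nhds (show (0 : ℝ) < 1 / 64 by norm_num))
  have e2 := h2.eventually (gt_mem_nhds (show (0 : ℝ) < 1 / 64 by norm_num))
  obtain ⟨N, hN⟩ := Filter.eventually_atTop.1 (e1.and e2)
  refine ⟨N, fun n hn => ?_⟩
  obtain ⟨a, b⟩ := hN n hn
  have hp : (2 : ℝ) ^ ((1 / 2 : ℝ) * n) = √2 ^ n := by
    rw [Real.rpow_mul (by norm_num), Real.rpow_natCast, Real.sqrt_eq_rpow]
  have hs : (2 : ℝ) ^ n = √2 ^ n * √2 ^ n := by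
    rw [← mul_pow, Real.mul_self_sqrt (by norm_num)]
  have hpos : 0 < √2 ^ n := by positivity
  rw [div_lt_iff₀ (by positivity)] at a b
  rw [hp]
  have := mul_le_mul_of_nonneg_right a.le hpos.le
  rw [pow_one, mul_assoc, ← hs] at this
  nlinarith

/-- There exist a constant `c > 0` and `N : ℕ` such that for all `n ≥ N`, the number
of rotation-swap-equivalence classes of binary words of length `n` containing at
least two occurrences of `true` and at least two occurrences of `false`, minus `n³`,
is at least `2^(c·n)` (as real numbers). -/
theorem stmt_5 :
    ∃ c : ℝ, 0 < c ∧ ∃ N : ℕ, ∀ n : ℕ, N ≤ n →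
      (2 : ℝ) ^ (c * n) ≤
        (Nat.card {q : Quotient (rotSwapSetoid n) //
          ∃ w : ZMod n → Bool, Quotient.mk (rotSwapSetoid n) w = q ∧
            2 ≤ Nat.card {i : ZMod n // w i = true} ∧
            2 ≤ Nat.card {i : ZMod n // w i = false}} : ℝ) - (n : ℝ) ^ 3 := by
  obtain ⟨N, hN⟩ := growth
  refine ⟨1 / 2, by norm_num, max N 4, fun n hn => ?_⟩
  have hn4 : 4 ≤ n := le_trans (le_max_right _ _) hn
  have : NeZero n := ⟨by omega⟩
  have hc := card_words_le n hn4
  have hg := hN n (le_trans (le_max_left _ _) hn)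
  generalize Nat.card _ = C at hc ⊢
  have hc' : (2 : ℝ) ^ (n - 4) ≤ n * 2 * C := by exact_mod_cast hc
  have h2 : (2 : ℝ) ^ n = 2 ^ (n - 4) * 16 := by
    rw [show (16 : ℝ) = 2 ^ 4 by norm_num, ← pow_add, Nat.sub_add_cancel hn4]
  have hnpos : (0 : ℝ) < n := by exact_mod_cast (by omega : 0 < n)
  rw [le_sub_iff_add_le]
  refine le_of_mul_le_mul_left ?_ hnpos
  nlinarith
end

section
/- Let k be a natural number and let b₁, …, b_{2k+1} be nonzero integers satisfying: (a) if k ≥ 1 then b₂ has the same sign as b₁; and (b) if k ≥ 1 and b₁ < 0 then b₃ < 0. Define F(b) = 1 + (2 + sgn(b₁) + sgn(b_{2k+1}))/4 + Σ_{1≤j≤k, b_{2j}>0} b_{2j}/2 + Σ_{0≤j≤k, b_{2j+1}<0} |b_{2j+1}|/2 ∈ ℚ. If F(b) = 2, then exactly one of the following holds: (i) k = 0 and b₁ > 0; (ii) k = 0 and b₁ = −2; or (iii) k = 1, b₁ = −1, b₂ < 0 and b₃ = −1. -/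
/-- Arithmetic case analysis for the braid-index formula of a 2-bridge link with
signed vector `(b 1, …, b (2k+1))` of nonzero integers. Here `sgn` is `Int.sign`
(which is `±1` on nonzero integers), hypothesis (a) is the sign propagation
`sign (b 2) = sign (b 1)` (when `k ≥ 1`), and hypothesis (b) states that if `k ≥ 1`
and `b 1 < 0` then `b 3 < 0`. If the braid-index formula value `F(b)` equals `2`,
then exactly one of: (i) `k = 0` and `b 1 > 0`; (ii) `k = 0` and `b 1 = -2`;
(iii) `k = 1`, `b 1 = -1`, `b 2 < 0` and `b 3 = -1` holds. -/
theorem stmt_7 (k : ℕ) (b : ℕ → ℤ)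
    (hnz : ∀ i : ℕ, 1 ≤ i → i ≤ 2 * k + 1 → b i ≠ 0)
    (ha : 1 ≤ k → (b 2).sign = (b 1).sign)
    (hb : 1 ≤ k → b 1 < 0 → b 3 < 0)
    (hF : (1 : ℚ) + (2 + ((b 1).sign : ℚ) + ((b (2 * k + 1)).sign : ℚ)) / 4
        + (∑ j ∈ Finset.Icc 1 k, if 0 < b (2 * j) then (b (2 * j) : ℚ) / 2 else 0)
        + (∑ j ∈ Finset.range (k + 1),
            if b (2 * j + 1) < 0 then (|b (2 * j + 1)| : ℚ) / 2 else 0)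
        = 2) :
    ((k = 0 ∧ 0 < b 1) ∧ ¬(k = 0 ∧ b 1 = -2)
        ∧ ¬(k = 1 ∧ b 1 = -1 ∧ b 2 < 0 ∧ b 3 = -1)) ∨
    (¬(k = 0 ∧ 0 < b 1) ∧ (k = 0 ∧ b 1 = -2)
        ∧ ¬(k = 1 ∧ b 1 = -1 ∧ b 2 < 0 ∧ b 3 = -1)) ∨
    (¬(k = 0 ∧ 0 < b 1) ∧ ¬(k = 0 ∧ b 1 = -2)
        ∧ (k = 1 ∧ b 1 = -1 ∧ b 2 < 0 ∧ b 3 = -1)) := by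
  have hs : ∀ x : ℤ, x ≠ 0 → (0 < x ∧ x.sign = 1) ∨ (x < 0 ∧ x.sign = -1) := by
    intro x hx
    rcases lt_or_gt_of_ne hx with h | h
    · exact Or.inr ⟨h, Int.sign_eq_neg_one_of_neg h⟩
    · exact Or.inl ⟨h, Int.sign_eq_one_of_pos h⟩
  have hneg : ∀ x : ℤ, x < 0 → (|x| : ℚ) = -(x : ℚ) ∧ (x : ℚ) ≤ -1 := by
    intro x hx
    have h1 : (x : ℚ) ≤ -1 := by exact_mod_cast (by omega : x ≤ -1)
    exact ⟨abs_of_neg (by linarith), h1⟩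
  have hf : ∀ j : ℕ, (0 : ℚ) ≤ if b (2 * j + 1) < 0 then (|b (2 * j + 1)| : ℚ) / 2 else 0 := by
    intro j
    split_ifs <;> positivity
  have hg : ∀ j : ℕ, (0 : ℚ) ≤ if 0 < b (2 * j) then (b (2 * j) : ℚ) / 2 else 0 := by
    intro j
    split_ifs with h
    · have : (0 : ℚ) < b (2 * j) := by exact_mod_cast h
      positivity
    · exact le_rfl
  have h1 := hs _ (hnz 1 le_rfl (by omega))
  rcases Nat.eq_zero_or_pos k with rfl | hk
  · rcases h1 with ⟨h, e⟩ | ⟨h, e⟩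
    · left
      refine ⟨⟨rfl, h⟩, by omega, by omega⟩
    · right; left
      have h' : ¬ 0 < b 1 := by omega
      simp [e, h, (hneg _ h).1] at hF
      have : (b 1 : ℚ) = -2 := by linarith
      have : b 1 = -2 := by exact_mod_cast this
      refine ⟨by omega, ⟨rfl, this⟩, by omega⟩
  right; right
  have ha := ha hk
  have hb := hb hk
  have hl := hs _ (hnz (2 * k + 1) (by omega) le_rfl)
  have hG := Finset.single_le_sum (fun j _ => hg j) (Finset.mem_Icc.mpr ⟨le_rfl, hk⟩)
  have hG0 := Finset.sum_nonneg (fun j (_ : j ∈ Finset.Icc 1 k) => hg j)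
  rcases h1 with ⟨h, e⟩ | ⟨h, e⟩
  · exfalso
    have h2 : 0 < b 2 := Int.sign_eq_one_iff_pos.mp (ha.trans e)
    have h2q : (1 : ℚ) ≤ b 2 := by exact_mod_cast h2
    simp only [mul_one, h2, if_true] at hG
    rcases hl with ⟨hl, el⟩ | ⟨hl, el⟩
    · have hS := Finset.sum_nonneg (fun j (_ : j ∈ Finset.range (k+1)) => hf j)
      rw [e, el] at hF
      push_cast at hF
      linarith
    · have hS := Finset.single_le_sum (fun j _ => hf j) (Finset.self_mem_range_succ k)
      rw [if_pos hl] at hS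
      obtain ⟨q1, q2⟩ := hneg _ hl
      rw [e, el] at hF
      push_cast at hF
      linarith
  · have h3 := hb h
    have h2 : b 2 < 0 := Int.sign_eq_neg_one_iff_neg.mp (ha.trans e)
    obtain ⟨p1, p2⟩ := hneg _ h
    obtain ⟨r1, r2⟩ := hneg _ h3
    have hlq : (-1 : ℚ) ≤ ((b (2 * k + 1)).sign : ℚ) := by
      rcases hl with ⟨_, el⟩ | ⟨_, el⟩ <;> rw [el] <;> norm_num
    have hS : ∀ s : Finset ℕ, s ⊆ Finset.range (k+1) → _ := fun s hs' =>
      Finset.sum_le_sum_of_subset_of_nonneg hs' (fun j _ _ => hf j)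
    have hS1 := hS {0, 1} (by intro x; simp; omega)
    rw [Finset.sum_pair (by norm_num)] at hS1
    simp only [mul_zero, zero_add, mul_one, Nat.reduceAdd, h, h3, if_true] at hS1
    have e1 : (b 1 : ℚ) = -1 := by rw [e] at hF; push_cast at hF; linarith
    have e3 : (b 3 : ℚ) = -1 := by rw [e] at hF; push_cast at hF; linarith
    have e1' : b 1 = -1 := by exact_mod_cast e1
    have e3' : b 3 = -1 := by exact_mod_cast e3
    have hk1 : k = 1 := by
      by_contra hne
      rw [e] at hF
      push_cast at hF
      rcases hl with ⟨hl, el⟩ | ⟨hl, el⟩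
      · rw [el] at hF
        push_cast at hF
        linarith
      · obtain ⟨q1, q2⟩ := hneg _ hl
        have hS2 := hS {0, 1, k} (by intro x; simp; omega)
        rw [Finset.sum_insert (by simp; omega), Finset.sum_pair (by omega), if_pos hl] at hS2
        simp only [mul_zero, zero_add, mul_one, Nat.reduceAdd, h, h3, if_true] at hS2
        linarith
    exact ⟨by omega, by omega, hk1, e1', h2, e3'⟩
end

section
/- Let q be a natural number and let b₁, …, b_{2q+1} be nonzero integers with b₁ < 0, satisfying: if q ≥ 1 and b₁ = −1 then b₃ < 0. Define Δ₂(b) = (2 + sgn(b₁) + sgn(b_{2q+1}))/4 + Σ_{1≤m≤q, b_{2m}>0} b_{2m}/2 + Σ_{0≤m≤q, b_{2m+1}<0} |b_{2m+1}|/2 ∈ ℚ. If Δ₂(b) = 1, then either q = 0 and b₁ = −2, or q = 1, b₁ = −1, b₂ < 0 and b₃ = −1. -/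
/-- Arithmetic core of the classification of Seifert Parity 2 tangles in BB
alternating Montesinos knots: for nonzero integers `b 1, …, b (2q+1)` with
`b 1 < 0`, satisfying the sign-propagation hypothesis (`q ≥ 1` and `b 1 = -1`
imply `b 3 < 0`), if the tangle contribution `Δ₂(b)` equals `1`, then either
`q = 0` and `b 1 = -2`, or `q = 1`, `b 1 = -1`, `b 2 < 0` and `b 3 = -1`. -/
theorem stmt_8 (q : ℕ) (b : ℕ → ℤ)
    (hnz : ∀ i : ℕ, 1 ≤ i → i ≤ 2 * q + 1 → b i ≠ 0)
    (hb1 : b 1 < 0)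
    (h3 : 1 ≤ q → b 1 = -1 → b 3 < 0)
    (hΔ : (2 + ((b 1).sign : ℚ) + ((b (2 * q + 1)).sign : ℚ)) / 4
        + (∑ m ∈ Finset.Icc 1 q, if 0 < b (2 * m) then (b (2 * m) : ℚ) / 2 else 0)
        + (∑ m ∈ Finset.range (q + 1),
            if b (2 * m + 1) < 0 then (|b (2 * m + 1)| : ℚ) / 2 else 0)
        = 1) :
    (q = 0 ∧ b 1 = -2) ∨ (q = 1 ∧ b 1 = -1 ∧ b 2 < 0 ∧ b 3 = -1) := by
  have hs1 : (b 1).sign = -1 := Int.sign_eq_neg_one_of_neg hb1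
  have hA : 0 ≤ ∑ m ∈ Finset.Icc 1 q, if 0 < b (2 * m) then (b (2 * m) : ℚ) / 2 else 0 := by
    apply Finset.sum_nonneg
    intro m _
    split_ifs with h
    · have : (0 : ℚ) < b (2 * m) := by exact_mod_cast h
      positivity
    · exact le_rfl
  have hq1 : (b 1 : ℚ) ≤ -1 := by
    have : b 1 ≤ -1 := by omega
    exact_mod_cast this
  have habs1 : |(b 1 : ℚ)| = -b 1 := abs_of_neg (by linarith)
  rcases q with _ | _ | k
  · left
    simp [hs1, hb1, habs1] at hΔ
    refine ⟨rfl, ?_⟩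
    have : (b 1 : ℚ) = -2 := by linarith
    exact_mod_cast this
  · right
    have hn3 := hnz 3 (by norm_num) (by norm_num)
    have hn2 := hnz 2 (by norm_num) (by norm_num)
    rcases lt_or_gt_of_ne hn3 with h | h
    · have hs3 : (b 3).sign = -1 := Int.sign_eq_neg_one_of_neg h
      have hq3 : (b 3 : ℚ) ≤ -1 := by
        have : b 3 ≤ -1 := by omega
        exact_mod_cast this
      have habs3 : |(b 3 : ℚ)| = -b 3 := abs_of_neg (by linarith)
      simp [Finset.sum_range_succ, hs1, hb1, habs1, hs3, h, habs3] at hΔ hA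
      have e1 : (b 1 : ℚ) = -1 := by linarith
      have e3 : (b 3 : ℚ) = -1 := by linarith
      refine ⟨rfl, by exact_mod_cast e1, ?_, by exact_mod_cast e3⟩
      rcases lt_or_gt_of_ne hn2 with h2 | h2
      · exact h2
      · exfalso
        have : (0 : ℚ) < b 2 := by exact_mod_cast h2
        simp [h2] at hΔ
        linarith
    · exfalso
      have hs3 : (b 3).sign = 1 := Int.sign_eq_one_of_pos h
      simp [Finset.sum_range_succ, hs1, hb1, habs1, hs3, not_lt.mpr h.le] at hΔ hA
      have e1 : (b 1 : ℚ) = -1 := by linarith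
      have := h3 (by norm_num) (by exact_mod_cast e1)
      omega
  · exfalso
    have hnn : ∀ m : ℕ, (0 : ℚ) ≤ if b (2 * m + 1) < 0 then (|b (2 * m + 1)| : ℚ) / 2 else 0 := by
      intro m
      split_ifs <;> positivity
    have hB := Finset.sum_nonneg (s := Finset.range k) (fun m _ => hnn (m + 1 + 1))
    rw [Finset.sum_range_succ, Finset.sum_range_succ', Finset.sum_range_succ'] at hΔ
    have hl := hnz (2 * (k + 1 + 1) + 1) (by omega) (by omega)
    have h1nn := hnn 1
    have hf1 : b 1 = -1 → (1 / 2 : ℚ) ≤ if b (2 * 1 + 1) < 0 then (|b (2 * 1 + 1)| : ℚ) / 2 else 0 := by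
      intro e
      have h := h3 (by omega) e
      have hq3 : (b 3 : ℚ) ≤ -1 := by
        have : b 3 ≤ -1 := by omega
        exact_mod_cast this
      have habs3 : |(b 3 : ℚ)| = -b 3 := abs_of_neg (by linarith)
      simp only [Nat.reduceMul, Nat.reduceAdd, h, if_true, habs3]
      linarith
    simp only [Nat.zero_add, Nat.mul_zero, hb1, if_true, habs1, hs1] at hΔ
    have hlast : (1 / 2 : ℚ) ≤ (1 + ((b (2 * (k + 1 + 1) + 1)).sign : ℚ)) / 4
        + if b (2 * (k + 1 + 1) + 1) < 0 then (|b (2 * (k + 1 + 1) + 1)| : ℚ) / 2 else 0 := by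
      generalize b (2 * (k + 1 + 1) + 1) = x at hl
      rcases lt_or_gt_of_ne hl with h | h
      · have hx : (x : ℚ) ≤ -1 := by
          have : x ≤ -1 := by omega
          exact_mod_cast this
        have hxa : |(x : ℚ)| = -x := abs_of_neg (by linarith)
        rw [Int.sign_eq_neg_one_of_neg h, if_pos h, hxa]
        push_cast
        linarith
      · rw [Int.sign_eq_one_of_pos h, if_neg (not_lt.mpr h.le)]
        norm_num
    push_cast at hΔ
    by_cases e : b 1 = -1
    · have := hf1 e
      linarith
    · have : (b 1 : ℚ) ≤ -2 := by
        have : b 1 ≤ -2 := by omega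
        exact_mod_cast this
      linarith
end

section
/- Let q be a natural number and let b₁, …, b_{2q+1} be nonzero integers with b₁ > 0, satisfying: if q ≥ 1 then b₂ > 0. Define Δ₃(b) = (−1 + sgn(b_{2q+1}))/4 + Σ_{1≤m≤q, b_{2m}>0} b_{2m}/2 + Σ_{0≤m≤q, b_{2m+1}<0} |b_{2m+1}|/2 ∈ ℚ. Then Δ₃(b) = 0 if and only if q = 0. -/
/-- Arithmetic core of the classification of Seifert Parity 3 tangles in BB
alternating Montesinos knots: for nonzero integers `b 1, …, b (2q+1)` with
`b 1 > 0`, satisfying the sign-propagation hypothesis (`q ≥ 1` implies `b 2 > 0`),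
the tangle contribution `Δ₃(b)` equals `0` if and only if `q = 0`. -/
theorem stmt_9 (q : ℕ) (b : ℕ → ℤ)
    (hnz : ∀ i : ℕ, 1 ≤ i → i ≤ 2 * q + 1 → b i ≠ 0)
    (hb1 : 0 < b 1)
    (hb2 : 1 ≤ q → 0 < b 2) :
    ((-1 + ((b (2 * q + 1)).sign : ℚ)) / 4
        + (∑ m ∈ Finset.Icc 1 q, if 0 < b (2 * m) then (b (2 * m) : ℚ) / 2 else 0)
        + (∑ m ∈ Finset.range (q + 1),
            if b (2 * m + 1) < 0 then (|b (2 * m + 1)| : ℚ) / 2 else 0)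
        = 0) ↔ q = 0 := by
  constructor
  · intro h
    by_contra hq
    have hq1 : 1 ≤ q := by omega
    have h2 : (1 : ℚ) ≤ b 2 := by exact_mod_cast hb2 hq1
    have e1 : (1 : ℚ) / 2 ≤ ∑ m ∈ Finset.Icc 1 q,
        if 0 < b (2 * m) then (b (2 * m) : ℚ) / 2 else 0 := by
      have hle := Finset.single_le_sum
        (f := fun m : ℕ => if 0 < b (2 * m) then (b (2 * m) : ℚ) / 2 else 0)
        (s := Finset.Icc 1 q) (a := 1)
        (by
          intro i _
          split_ifs with hi
          · have : (0 : ℚ) < b (2 * i) := by exact_mod_cast hi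
            positivity
          · exact le_rfl)
        (by simp [hq1])
      have h3 := hb2 hq1
      simp only [mul_one, if_pos h3] at hle
      linarith
    have nn : ∀ i ∈ Finset.range (q + 1),
        (0 : ℚ) ≤ if b (2 * i + 1) < 0 then (|b (2 * i + 1)| : ℚ) / 2 else 0 := by
      intro i _
      split_ifs <;> positivity
    rcases lt_or_gt_of_ne (hnz (2 * q + 1) (by omega) le_rfl) with hn | hp
    · have hle := Finset.single_le_sum nn (Finset.self_mem_range_succ q)
      rw [if_pos hn] at hle
      have h4 : (b (2 * q + 1) : ℚ) ≤ -1 := by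
        have : b (2 * q + 1) ≤ -1 := by omega
        exact_mod_cast this
      have h5 := neg_le_abs (b (2 * q + 1) : ℚ)
      rw [Int.sign_eq_neg_one_of_neg hn] at h
      push_cast at h
      linarith
    · have hge := Finset.sum_nonneg nn
      rw [Int.sign_eq_one_of_pos hp] at h
      push_cast at h
      linarith
  · rintro rfl
    simp [Int.sign_eq_one_of_pos hb1, not_lt.mpr hb1.le]
end
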